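/- arXiv:2105.12958 — 2 statements merged into one kernel-verified Lean document; each statement's English description precedes it below -/
import Mathlib

section
/- Let f be a translation invariant quadratic form with integer coefficients in s variables, let p be a prime and let k ≥ 1 be an integer. Then the number of tuples x = (x₁,…,x_s) with 1 ≤ x_i ≤ p^{k+2}, gcd(x_i, p) = 1 for all i, and f(x) ≡ 0 (mod p^{k+2}) is at least p^s times the number of tuples y = (y₁,…,y_s) with 1 ≤ y_i ≤ p^k and f(y) ≡ 0 (mod p^k). -/
open scoped BigOperators

noncomputable section

attribute [local instance] Classical.propDecidable

/-- `e(z) = e^{2πiz}`. -/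
def eC (x : ℝ) : ℂ := Complex.exp (2 * Real.pi * Complex.I * x)

/-- The quadratic form `f(x) = x M xᵀ`. -/
def Qf {s : ℕ} (M : Matrix (Fin s) (Fin s) ℤ) (x : Fin s → ℤ) : ℤ :=
  ∑ i, ∑ j, x i * M i j * x j

/-- The Gauss sum `S*_{W,b}(q,a)`. -/
def SstarG {s : ℕ} (M : Matrix (Fin s) (Fin s) ℤ) (W : ℕ) (b : ℤ) (q : ℕ) (a : ℤ) : ℂ :=
  ∑ c ∈ Fintype.piFinset (fun _ : Fin s => Finset.Icc 1 (q * W)),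
    if ∀ i, Nat.gcd (c i) q = 1 ∧ (c i : ℤ) ≡ b [ZMOD (W : ℤ)] then
      eC (((a * Qf M (fun i => (c i : ℤ))) : ℝ) / (q : ℝ))
    else 0

/-- The complete sum `S(q,a)`. -/
def SfullG {s : ℕ} (M : Matrix (Fin s) (Fin s) ℤ) (q : ℕ) (a : ℤ) : ℂ :=
  ∑ c ∈ Fintype.piFinset (fun _ : Fin s => Finset.Icc 1 q),
    eC (((a * Qf M (fun i => (c i : ℤ))) : ℝ) / (q : ℝ))

/-- `B*_{W,b}(q) = φ(qW)^{-s} ∑_{1 ≤ a ≤ q, (a,q)=1} S*_{W,b}(q,a)`. -/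
def BstarG {s : ℕ} (M : Matrix (Fin s) (Fin s) ℤ) (W : ℕ) (b : ℤ) (q : ℕ) : ℂ :=
  ((Nat.totient (q * W) : ℂ) ^ s)⁻¹ *
    ∑ a ∈ Finset.Icc 1 q, if Nat.gcd a q = 1 then SstarG M W b q (a : ℤ) else 0

/-- `B(q) = q^{-s} ∑_{1 ≤ a ≤ q, (a,q)=1} S(q,a)`. -/
def BfullG {s : ℕ} (M : Matrix (Fin s) (Fin s) ℤ) (q : ℕ) : ℂ :=
  ((q : ℂ) ^ s)⁻¹ *
    ∑ a ∈ Finset.Icc 1 q, if Nat.gcd a q = 1 then SfullG M q (a : ℤ) else 0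

/-- `f` is translation invariant, i.e. `1 · M = 0`. -/
def TransInv {s : ℕ} (M : Matrix (Fin s) (Fin s) ℤ) : Prop :=
  ∀ j, ∑ i, M i j = 0

theorem Qf_mul_sub_one {s : ℕ} {M : Matrix (Fin s) (Fin s) ℤ} (hsym : M.IsSymm)
    (htri : TransInv M) (c : ℤ) (u : Fin s → ℤ) :
    Qf M (fun i => c * u i - 1) = c ^ 2 * Qf M u := by
  have hrow : ∀ i, ∑ j, M i j = 0 := fun i => by
    rw [← htri i]
    exact Finset.sum_congr rfl fun j _ => hsym.apply j i
  have hexp : ∀ i j, (c * u i - 1) * M i j * (c * u j - 1) =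
      c ^ 2 * (u i * M i j * u j) - c * u i * M i j - c * u j * M i j + M i j :=
    fun i j => by ring
  have hcol : ∑ i, ∑ j, c * u j * M i j = 0 := by
    rw [Finset.sum_comm]
    simp [← Finset.mul_sum, htri _]
  simp only [Qf, hexp, Finset.sum_add_distrib, Finset.sum_sub_distrib, hcol,
    ← Finset.mul_sum, hrow]
  simp

theorem Qf_modEq {s : ℕ} (M : Matrix (Fin s) (Fin s) ℤ) {n : ℤ} {u v : Fin s → ℤ}
    (h : ∀ i, u i ≡ v i [ZMOD n]) : Qf M u ≡ Qf M v [ZMOD n] :=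
  Int.ModEq.sum fun i _ => Int.ModEq.sum fun j _ => ((h i).mul_right _).mul (h j)

theorem Nat.eq_and_eq_of_add_mul_eq {q a b d e : ℕ} (ha : 1 ≤ a) (haq : a ≤ q) (hb : 1 ≤ b)
    (hbq : b ≤ q) (h : a + q * d = b + q * e) : a = b ∧ d = e := by
  have hde : d = e := by
    rcases lt_trichotomy d e with hlt | heq | hlt
    · nlinarith [Nat.mul_le_mul_left q (Nat.succ_le_of_lt hlt)]
    · exact heq
    · nlinarith [Nat.mul_le_mul_left q (Nat.succ_le_of_lt hlt)]
  subst hde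
  exact ⟨by omega, rfl⟩

theorem statement9 {s : ℕ} (M : Matrix (Fin s) (Fin s) ℤ) (hsym : M.IsSymm)
    (htri : TransInv M) (p : ℕ) (hp : Nat.Prime p) (k : ℕ) (hk : 1 ≤ k) :
    p ^ s * ((Fintype.piFinset fun _ : Fin s => Finset.Icc 1 (p ^ k)).filter
        fun y => Qf M (fun i => (y i : ℤ)) % (p : ℤ) ^ k = 0).card ≤
      ((Fintype.piFinset fun _ : Fin s => Finset.Icc 1 (p ^ (k + 2))).filter
        fun x => (∀ i, Nat.gcd (x i) p = 1) ∧
          Qf M (fun i => (x i : ℤ)) % (p : ℤ) ^ (k + 2) = 0).card := by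
  have hp2 := hp.two_le
  have hcard : (Fintype.piFinset fun _ : Fin s => Finset.range p).card = p ^ s := by simp
  rw [← hcard, ← Finset.card_product]
  have hpos : ∀ y e : ℕ, 1 ≤ y → 2 ≤ p * (y + p ^ k * e) := fun y e hy => by
    nlinarith [Nat.mul_le_mul hp2 (show 1 ≤ y + p ^ k * e by omega)]
  apply Finset.card_le_card_of_injOn
    (fun z : (Fin s → ℕ) × (Fin s → ℕ) => fun i => p * (z.2 i + p ^ k * z.1 i) - 1)
  · rintro ⟨e, y⟩ h
    simp only [Finset.coe_product, Set.mem_prod, Finset.mem_coe, Finset.mem_filter,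
      Fintype.mem_piFinset, Finset.mem_range, Finset.mem_Icc] at h ⊢
    obtain ⟨he, hy, hf⟩ := h
    have hge : ∀ i, 2 ≤ p * (y i + p ^ k * e i) := fun i => hpos _ _ (hy i).1
    refine ⟨fun i => ⟨by have := hge i; omega, ?_⟩, fun i => ?_, ?_⟩
    · have hu : y i + p ^ k * e i ≤ p ^ k * p := by
        nlinarith [(hy i).2, Nat.mul_le_mul_left (p ^ k) (Nat.succ_le_of_lt (he i))]
      calc p * (y i + p ^ k * e i) - 1 ≤ p * (y i + p ^ k * e i) := Nat.sub_le _ _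
        _ ≤ p * (p ^ k * p) := Nat.mul_le_mul_left p hu
        _ = p ^ (k + 2) := by ring
    · rw [Nat.gcd_comm]
      refine (Nat.Prime.coprime_iff_not_dvd hp).2 fun hd => ?_
      have hone := (Nat.dvd_sub_iff_right (show 1 ≤ p * (y i + p ^ k * e i) by
        have := hge i; omega) (dvd_mul_right p _)).1 hd
      exact hp.one_lt.ne' (Nat.dvd_one.1 hone)
    · have hx : (fun i => ((p * (y i + p ^ k * e i) - 1 : ℕ) : ℤ)) =
          fun i => (p : ℤ) * ((y i : ℤ) + (p : ℤ) ^ k * (e i : ℤ)) - 1 := by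
        funext i
        rw [Nat.cast_sub (by have := hge i; omega)]
        push_cast
        ring
      rw [hx, Qf_mul_sub_one hsym htri (p : ℤ) fun i => (y i : ℤ) + (p : ℤ) ^ k * (e i : ℤ),
        pow_add, mul_comm ((p : ℤ) ^ k)]
      refine Int.emod_eq_zero_of_dvd (mul_dvd_mul_left _ (Int.dvd_of_emod_eq_zero ?_))
      rw [← hf]
      exact Qf_modEq M fun i => by simp [Int.ModEq]
  · rintro ⟨e, y⟩ h ⟨e', y'⟩ h' heq
    simp only [Finset.coe_product, Set.mem_prod, Finset.mem_coe, Finset.mem_filter,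
      Fintype.mem_piFinset, Finset.mem_range, Finset.mem_Icc] at h h'
    have key : ∀ i, y i = y' i ∧ e i = e' i := fun i => by
      have hi : p * (y i + p ^ k * e i) - 1 = p * (y' i + p ^ k * e' i) - 1 := congrFun heq i
      have h1 := hpos (y i) (e i) (h.2.1 i).1
      have h2 := hpos (y' i) (e' i) (h'.2.1 i).1
      exact Nat.eq_and_eq_of_add_mul_eq (h.2.1 i).1 (h.2.1 i).2 (h'.2.1 i).1 (h'.2.1 i).2
        (Nat.eq_of_mul_eq_mul_left hp.pos (by omega))
    exact Prod.ext (funext fun i => (key i).2) (funext fun i => (key i).1)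
end
end

section
/- Let f be a translation invariant quadratic form with integer coefficients in s variables, let p be a prime, let b be an integer with gcd(b,p) = 1, and let t ≥ 1 be an integer. Then for every integer K ≥ 0, ∑_{k=0}^{2t+K} B*_{p^t,b}(p^k) = (p^{2t}/φ(p^t)^s) · ∑_{k=0}^{K} B(p^k). -/
open scoped BigOperators

noncomputable section

attribute [local instance] Classical.propDecidable

theorem eC_add_intCast (x : ℝ) (n : ℤ) : eC (x + n) = eC x := by
  unfold eC
  rw [Complex.exp_eq_exp_iff_exists_int]
  exact ⟨n, by push_cast; ring⟩

theorem eC_div_congr {q : ℕ} (hq : 0 < q) {A B : ℤ} (h : A ≡ B [ZMOD q]) :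
    eC ((A : ℝ) / q) = eC ((B : ℝ) / q) := by
  obtain ⟨n, hn⟩ := h.symm.dvd
  have hq' : (q : ℝ) ≠ 0 := by positivity
  rw [← eC_add_intCast ((B : ℝ) / q) n, show A = B + q * n by linarith]
  congr 1
  push_cast
  field_simp

theorem Qf_congr {s : ℕ} (M : Matrix (Fin s) (Fin s) ℤ) {n : ℤ} {x y : Fin s → ℤ}
    (h : ∀ i, x i ≡ y i [ZMOD n]) : Qf M x ≡ Qf M y [ZMOD n] := by
  refine Int.modEq_iff_dvd.2 ?_
  unfold Qf
  simp only [← Finset.sum_sub_distrib]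
  exact Finset.dvd_sum fun i _ => Finset.dvd_sum fun j _ =>
    (((h i).mul_right (M i j)).mul (h j)).dvd

theorem Qf_smul {s : ℕ} (M : Matrix (Fin s) (Fin s) ℤ) (k : ℤ) (x : Fin s → ℤ) :
    Qf (k • M) x = k * Qf M x := by
  simp only [Qf, Finset.mul_sum, Matrix.smul_apply, smul_eq_mul]
  exact Finset.sum_congr rfl fun i _ => Finset.sum_congr rfl fun j _ => by ring

theorem Qf_const_add_mul {s : ℕ} {M : Matrix (Fin s) (Fin s) ℤ} (hsym : M.IsSymm)
    (htri : TransInv M) (k w : ℤ) (x : Fin s → ℤ) :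
    Qf M (fun i => k + w * x i) = w ^ 2 * Qf M x := by
  have hrow (i : Fin s) : ∑ j, M i j = 0 := by
    rw [← htri i]
    exact Finset.sum_congr rfl fun j _ => hsym.apply j i
  have hcol : ∑ i, ∑ j, k * M i j * (k + w * x j) = 0 := by
    rw [Finset.sum_comm]
    refine Finset.sum_eq_zero fun j _ => ?_
    rw [← Finset.sum_mul, ← Finset.mul_sum, htri j]
    ring
  have hmix : ∑ i, ∑ j, w * x i * M i j * k = 0 := by
    refine Finset.sum_eq_zero fun i _ => ?_
    rw [← Finset.sum_mul, ← Finset.mul_sum, hrow i]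
    ring
  have hsplit : Qf M (fun i => k + w * x i) = ∑ i, ∑ j, k * M i j * (k + w * x j) +
      ∑ i, ∑ j, w * x i * M i j * k + w ^ 2 * Qf M x := by
    simp only [Qf, Finset.mul_sum, ← Finset.sum_add_distrib]
    exact Finset.sum_congr rfl fun i _ => Finset.sum_congr rfl fun j _ => by ring
  rw [hsplit, hcol, hmix]
  ring

theorem add_mul_mem_Icc {q m d e : ℕ} (hd : d ∈ Finset.Icc 1 q) (he : e ∈ Finset.range m) :
    d + q * e ∈ Finset.Icc 1 (q * m) := by
  simp only [Finset.mem_Icc, Finset.mem_range] at *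
  refine ⟨by omega, ?_⟩
  calc d + q * e ≤ q * (e + 1) := by rw [mul_add]; omega
    _ ≤ q * m := Nat.mul_le_mul_left q he

theorem sub_one_mod_add_one_mem_Icc {q : ℕ} (hq : 0 < q) (c : ℕ) :
    (c - 1) % q + 1 ∈ Finset.Icc 1 q := by
  have := Nat.mod_lt (c - 1) hq
  simp only [Finset.mem_Icc]
  omega

theorem sub_one_div_mem_range {q m c : ℕ} (hc : c ∈ Finset.Icc 1 (q * m)) :
    (c - 1) / q ∈ Finset.range m := by
  simp only [Finset.mem_Icc, Finset.mem_range] at *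
  exact Nat.div_lt_of_lt_mul (by omega)

theorem sub_one_mod_add_one_add {q c : ℕ} (hc : 1 ≤ c) :
    (c - 1) % q + 1 + q * ((c - 1) / q) = c := by
  have := Nat.mod_add_div (c - 1) q
  omega

theorem add_mul_sub_one_mod {q d : ℕ} (hd : d ∈ Finset.Icc 1 q) (e : ℕ) :
    (d + q * e - 1) % q + 1 = d := by
  simp only [Finset.mem_Icc] at hd
  rw [show d + q * e - 1 = d - 1 + q * e by omega, Nat.add_mul_mod_self_left,
    Nat.mod_eq_of_lt (by omega)]
  omega

theorem add_mul_sub_one_div {q d : ℕ} (hd : d ∈ Finset.Icc 1 q) (e : ℕ) :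
    (d + q * e - 1) / q = e := by
  simp only [Finset.mem_Icc] at hd
  rw [show d + q * e - 1 = d - 1 + q * e by omega, Nat.add_mul_div_left _ _ (by omega),
    Nat.div_eq_of_lt (by omega)]
  omega

theorem sum_Icc_mul_of_periodic {q : ℕ} (hq : 0 < q) (m : ℕ) {g : ℕ → ℂ}
    (hg : ∀ d e, g (d + q * e) = g d) :
    ∑ c ∈ Finset.Icc 1 (q * m), g c = m * ∑ d ∈ Finset.Icc 1 q, g d := by
  have h : ∑ c ∈ Finset.Icc 1 (q * m), g c =
      ∑ x ∈ Finset.Icc 1 q ×ˢ Finset.range m, g x.1 := by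
    refine Finset.sum_bij' (fun c _ => ((c - 1) % q + 1, (c - 1) / q))
      (fun x _ => x.1 + q * x.2) ?_ ?_ ?_ ?_ ?_
    · intro c hc
      exact Finset.mem_product.2
        ⟨sub_one_mod_add_one_mem_Icc hq c, sub_one_div_mem_range hc⟩
    · intro x hx
      exact add_mul_mem_Icc (Finset.mem_product.1 hx).1 (Finset.mem_product.1 hx).2
    · intro c hc
      exact sub_one_mod_add_one_add (Finset.mem_Icc.1 hc).1
    · intro x hx
      have hx1 := (Finset.mem_product.1 hx).1
      exact Prod.ext (add_mul_sub_one_mod hx1 _) (add_mul_sub_one_div hx1 _)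
    · intro c hc
      conv_lhs => rw [← sub_one_mod_add_one_add (q := q) (Finset.mem_Icc.1 hc).1, hg]
  rw [h, Finset.sum_product, Finset.mul_sum]
  simp

theorem sum_piFinset_Icc_mul_of_periodic {ι : Type*} [Fintype ι] [DecidableEq ι]
    {q : ℕ} (hq : 0 < q) (m : ℕ) {g : (ι → ℕ) → ℂ}
    (hg : ∀ d e : ι → ℕ, g (fun i => d i + q * e i) = g d) :
    ∑ c ∈ Fintype.piFinset (fun _ : ι => Finset.Icc 1 (q * m)), g c =
      (m : ℂ) ^ Fintype.card ι *
        ∑ d ∈ Fintype.piFinset (fun _ : ι => Finset.Icc 1 q), g d := by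
  have h : ∑ c ∈ Fintype.piFinset (fun _ : ι => Finset.Icc 1 (q * m)), g c =
      ∑ x ∈ Fintype.piFinset (fun _ : ι => Finset.Icc 1 q) ×ˢ
        Fintype.piFinset (fun _ : ι => Finset.range m), g x.1 := by
    refine Finset.sum_bij' (fun c _ => (fun i => (c i - 1) % q + 1, fun i => (c i - 1) / q))
      (fun x _ i => x.1 i + q * x.2 i) ?_ ?_ ?_ ?_ ?_
    · intro c hc
      rw [Fintype.mem_piFinset] at hc
      exact Finset.mem_product.2
        ⟨Fintype.mem_piFinset.2 fun i => sub_one_mod_add_one_mem_Icc hq (c i),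
          Fintype.mem_piFinset.2 fun i => sub_one_div_mem_range (hc i)⟩
    · intro x hx
      obtain ⟨h1, h2⟩ := Finset.mem_product.1 hx
      exact Fintype.mem_piFinset.2 fun i =>
        add_mul_mem_Icc (Fintype.mem_piFinset.1 h1 i) (Fintype.mem_piFinset.1 h2 i)
    · intro c hc
      rw [Fintype.mem_piFinset] at hc
      exact funext fun i => sub_one_mod_add_one_add (Finset.mem_Icc.1 (hc i)).1
    · intro x hx
      have h1 := Fintype.mem_piFinset.1 (Finset.mem_product.1 hx).1
      exact Prod.ext (funext fun i => add_mul_sub_one_mod (h1 i) _)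
        (funext fun i => add_mul_sub_one_div (h1 i) _)
    · intro c hc
      rw [Fintype.mem_piFinset] at hc
      rw [← hg (fun i => (c i - 1) % q + 1) (fun i => (c i - 1) / q)]
      exact congrArg g
        (funext fun i => (sub_one_mod_add_one_add (Finset.mem_Icc.1 (hc i)).1).symm)
  rw [h, Finset.sum_product, Finset.mul_sum]
  simp

theorem SfullG_congr {s : ℕ} (M : Matrix (Fin s) (Fin s) ℤ) {q : ℕ} (hq : 0 < q) {a a' : ℤ}
    (h : a ≡ a' [ZMOD q]) : SfullG M q a = SfullG M q a' := by
  refine Finset.sum_congr rfl fun c _ => ?_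
  exact_mod_cast eC_div_congr hq (h.mul_right (Qf M fun i => (c i : ℤ)))

/-- Enlarging the modulus by `m` while multiplying the phase by `m` repeats the complete sum. -/
theorem sum_piFinset_eC_mul {s : ℕ} (M : Matrix (Fin s) (Fin s) ℤ) {q m : ℕ} (hq : 0 < q)
    (hm : 0 < m) (a : ℤ) :
    ∑ c ∈ Fintype.piFinset (fun _ : Fin s => Finset.Icc 1 (q * m)),
      eC (((m * a * Qf M (fun i => (c i : ℤ)) : ℤ) : ℝ) / ((q * m : ℕ) : ℝ)) =
      (m : ℂ) ^ s * SfullG M q a := by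
  have hm' : (m : ℝ) ≠ 0 := by positivity
  have hq' : (q : ℝ) ≠ 0 := by positivity
  have hcancel (c : Fin s → ℕ) :
      eC (((m * a * Qf M (fun i => (c i : ℤ)) : ℤ) : ℝ) / ((q * m : ℕ) : ℝ)) =
        eC ((a * Qf M (fun i => (c i : ℤ)) : ℝ) / q) := by
    congr 1
    push_cast
    field_simp
  simp only [hcancel]
  rw [sum_piFinset_Icc_mul_of_periodic hq m, Fintype.card_fin, SfullG]
  intro d e
  have hQ : Qf M (fun i => ((d i + q * e i : ℕ) : ℤ)) ≡ Qf M (fun i => (d i : ℤ)) [ZMOD q] :=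
    Qf_congr M fun i => by
      push_cast
      exact Int.modEq_iff_dvd.2 ⟨-e i, by ring⟩
  exact_mod_cast eC_div_congr hq (hQ.mul_left a)

theorem SfullG_mul {s : ℕ} (M : Matrix (Fin s) (Fin s) ℤ) {q m : ℕ} (hq : 0 < q)
    (hm : 0 < m) (a : ℤ) : SfullG M (q * m) (m * a) = (m : ℂ) ^ s * SfullG M q a := by
  rw [← sum_piFinset_eC_mul M hq hm a, SfullG]
  push_cast
  rfl

theorem SfullG_smul {s : ℕ} (M : Matrix (Fin s) (Fin s) ℤ) {q m : ℕ} (hq : 0 < q)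
    (hm : 0 < m) (a : ℤ) :
    SfullG ((m : ℤ) • M) (q * m) a = (m : ℂ) ^ s * SfullG M q a := by
  rw [← sum_piFinset_eC_mul M hq hm a, SfullG]
  refine Finset.sum_congr rfl fun c _ => ?_
  rw [Qf_smul]
  push_cast
  congr 2
  ring

/-- The normalized sum of `S(q,a)` over all residues `a` modulo `q`. -/
def totalG {s : ℕ} (M : Matrix (Fin s) (Fin s) ℤ) (q : ℕ) : ℂ :=
  ((q : ℂ) ^ s)⁻¹ * ∑ a ∈ Finset.Icc 1 q, SfullG M q (a : ℤ)

theorem totalG_smul {s : ℕ} (M : Matrix (Fin s) (Fin s) ℤ) {q m : ℕ} (hq : 0 < q)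
    (hm : 0 < m) : totalG ((m : ℤ) • M) (q * m) = m * totalG M q := by
  have hm' : (m : ℂ) ≠ 0 := by exact_mod_cast hm.ne'
  have hq' : (q : ℂ) ≠ 0 := by exact_mod_cast hq.ne'
  simp only [totalG, SfullG_smul M hq hm]
  rw [← Finset.mul_sum, sum_Icc_mul_of_periodic hq m]
  · push_cast
    field_simp
    rw [mul_pow]
    ring
  · intro d e
    refine SfullG_congr M hq ?_
    push_cast
    exact Int.modEq_iff_dvd.2 ⟨-e, by ring⟩

theorem BfullG_prime_pow_succ {s : ℕ} (M : Matrix (Fin s) (Fin s) ℤ) {p : ℕ}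
    (hp : p.Prime) (n : ℕ) :
    BfullG M (p ^ (n + 1)) = totalG M (p ^ (n + 1)) - totalG M (p ^ n) := by
  have hp' : (p : ℂ) ≠ 0 := by exact_mod_cast hp.ne_zero
  have hmult : ∑ a ∈ Finset.Icc 1 (p ^ (n + 1)) with ¬ Nat.gcd a (p ^ (n + 1)) = 1,
      SfullG M (p ^ (n + 1)) (a : ℤ) =
      ∑ a ∈ Finset.Icc 1 (p ^ n), (p : ℂ) ^ s * SfullG M (p ^ n) (a : ℤ) := by
    symm
    refine Finset.sum_bij (fun a _ => p * a) ?_ ?_ ?_ ?_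
    · intro a ha
      simp only [Finset.mem_filter, Finset.mem_Icc] at ha ⊢
      refine ⟨⟨Nat.mul_pos hp.pos ha.1, ?_⟩, ?_⟩
      · rw [pow_succ']
        exact Nat.mul_le_mul_left p ha.2
      · intro h
        exact hp.one_lt.ne' (Nat.dvd_one.1
          (h ▸ Nat.dvd_gcd (dvd_mul_right p a) (dvd_pow_self p n.succ_ne_zero)))
    · intro a _ b _ h
      exact Nat.eq_of_mul_eq_mul_left hp.pos h
    · intro a ha
      simp only [Finset.mem_filter, Finset.mem_Icc] at ha
      have hdvd : p ∣ a := by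
        by_contra h
        exact ha.2 (((hp.coprime_iff_not_dvd.2 h).symm).pow_right (n + 1))
      obtain ⟨b, rfl⟩ := hdvd
      refine ⟨b, Finset.mem_Icc.2 ⟨Nat.pos_of_mul_pos_left ha.1.1, ?_⟩, rfl⟩
      rw [pow_succ'] at ha
      exact Nat.le_of_mul_le_mul_left ha.1.2 hp.pos
    · intro a _
      rw [pow_succ, Nat.cast_mul, SfullG_mul M (pow_pos hp.pos n) hp.pos]
  have hsplit := Finset.sum_filter_add_sum_filter_not (Finset.Icc 1 (p ^ (n + 1)))
    (fun a => Nat.gcd a (p ^ (n + 1)) = 1) (fun a => SfullG M (p ^ (n + 1)) (a : ℤ))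
  rw [hmult, ← Finset.mul_sum] at hsplit
  simp only [BfullG, totalG, ← Finset.sum_filter]
  rw [← hsplit]
  push_cast
  field_simp
  ring

theorem sum_BfullG_prime_pow {s : ℕ} (M : Matrix (Fin s) (Fin s) ℤ) {p : ℕ}
    (hp : p.Prime) (n : ℕ) :
    ∑ k ∈ Finset.range (n + 1), BfullG M (p ^ k) = totalG M (p ^ n) := by
  induction n with
  | zero => simp [BfullG, totalG]
  | succ n ih =>
    rw [Finset.sum_range_succ, ih, BfullG_prime_pow_succ M hp]
    ring

/-- Substituting `c = r + W (d - 1)` with `r ≡ b (mod W)` turns `S*` into a complete sum. -/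
theorem SstarG_eq_SfullG {s : ℕ} {M : Matrix (Fin s) (Fin s) ℤ} (hsym : M.IsSymm)
    (htri : TransInv M) {W q : ℕ} (hW : 0 < W) (b : ℤ)
    (hcop : ∀ c : ℕ, (c : ℤ) ≡ b [ZMOD W] → Nat.gcd c q = 1) (a : ℤ) :
    SstarG M W b q a = SfullG ((W ^ 2 : ℤ) • M) q a := by
  obtain ⟨r, hr, hrb⟩ : ∃ r ∈ Finset.Icc 1 W, (r : ℤ) ≡ b [ZMOD W] := by
    have hW' : (0 : ℤ) < W := by exact_mod_cast hW
    have h0 := Int.emod_nonneg (b - 1) hW'.ne'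
    have h1 := Int.emod_lt_of_pos (b - 1) hW'
    refine ⟨((b - 1) % W).toNat + 1, by simp only [Finset.mem_Icc]; omega, ?_⟩
    push_cast
    rw [Int.toNat_of_nonneg h0]
    simpa using (Int.mod_modEq (b - 1) W).add_right 1
  rw [SstarG, ← Finset.sum_filter, SfullG]
  symm
  refine Finset.sum_bij' (fun d _ i => r + W * (d i - 1)) (fun c _ i => (c i - 1) / W + 1)
    ?_ ?_ ?_ ?_ ?_
  · intro d hd
    rw [Fintype.mem_piFinset] at hd
    have hmod (i : Fin s) : ((r + W * (d i - 1) : ℕ) : ℤ) ≡ b [ZMOD W] := by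
      refine Int.ModEq.trans ?_ hrb
      push_cast
      exact Int.modEq_iff_dvd.2 ⟨-(d i - 1 : ℕ), by ring⟩
    refine Finset.mem_filter.2 ⟨Fintype.mem_piFinset.2 fun i => ?_,
      fun i => ⟨hcop _ (hmod i), hmod i⟩⟩
    have := Finset.mem_Icc.1 (hd i)
    rw [mul_comm q W]
    exact add_mul_mem_Icc hr (Finset.mem_range.2 (by omega))
  · intro c hc
    obtain ⟨hc, -⟩ := Finset.mem_filter.1 hc
    rw [Fintype.mem_piFinset, mul_comm q W] at hc
    refine Fintype.mem_piFinset.2 fun i => ?_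
    have := Finset.mem_range.1 (sub_one_div_mem_range (hc i))
    exact Finset.mem_Icc.2 ⟨Nat.le_add_left _ _, this⟩
  · intro d hd
    rw [Fintype.mem_piFinset] at hd
    funext i
    have := Finset.mem_Icc.1 (hd i)
    rw [add_mul_sub_one_div hr]
    omega
  · intro c hc
    obtain ⟨hc, hcb⟩ := Finset.mem_filter.1 hc
    rw [Fintype.mem_piFinset] at hc
    funext i
    have h1 := sub_one_mod_add_one_add (q := W) (Finset.mem_Icc.1 (hc i)).1
    have hcr : c i ≡ r [MOD W] :=
      Int.natCast_modEq_iff.1 ((hcb i).2.trans hrb.symm)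
    have hrem : (c i - 1) % W = (r - 1) % W := by
      refine Nat.ModEq.add_right_cancel' 1 ?_
      rwa [Nat.sub_add_cancel (Finset.mem_Icc.1 (hc i)).1,
        Nat.sub_add_cancel (Finset.mem_Icc.1 hr).1]
    have h2 := Finset.mem_Icc.1 hr
    rw [Nat.mod_eq_of_lt (by omega : r - 1 < W)] at hrem
    simp only [Nat.add_sub_cancel]
    omega
  · intro d hd
    rw [Fintype.mem_piFinset] at hd
    have hQ : Qf M (fun i => ((r + W * (d i - 1) : ℕ) : ℤ)) =
        (W : ℤ) ^ 2 * Qf M fun i => (d i : ℤ) := by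
      rw [← Qf_const_add_mul hsym htri (r - W) W]
      congr 1
      funext i
      push_cast [Nat.cast_sub (Finset.mem_Icc.1 (hd i)).1]
      ring
    rw [hQ, Qf_smul]

theorem BstarG_prime_pow {s : ℕ} {M : Matrix (Fin s) (Fin s) ℤ} (hsym : M.IsSymm)
    (htri : TransInv M) {p : ℕ} (hp : p.Prime) {b : ℤ} (hb : Int.gcd b p = 1) {t : ℕ}
    (ht : 1 ≤ t) (k : ℕ) :
    BstarG M (p ^ t) b (p ^ k) =
      ((Nat.totient (p ^ t) : ℂ) ^ s)⁻¹ * BfullG (((p ^ (2 * t) : ℕ) : ℤ) • M) (p ^ k) := by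
  have hcop (c : ℕ) (hc : (c : ℤ) ≡ b [ZMOD (p ^ t : ℕ)]) : Nat.gcd c (p ^ k) = 1 := by
    have hcp : (c : ℤ) ≡ b [ZMOD p] :=
      hc.of_dvd (by exact_mod_cast dvd_pow_self p (by omega))
    refine Nat.Coprime.pow_right k (Nat.Coprime.symm (hp.coprime_iff_not_dvd.2 fun h => ?_))
    have hpb : (p : ℤ) ∣ b := hcp.dvd_iff.1 (by exact_mod_cast h)
    have := Int.dvd_coe_gcd hpb (dvd_refl (p : ℤ))
    rw [hb] at this
    exact hp.one_lt.ne' (Nat.dvd_one.1 (by exact_mod_cast this))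
  have htot : Nat.totient (p ^ k * p ^ t) = p ^ k * Nat.totient (p ^ t) := by
    rw [← pow_add, Nat.totient_prime_pow hp (by omega), Nat.totient_prime_pow hp (by omega),
      ← mul_assoc, ← pow_add]
    congr 2
    omega
  simp only [BstarG, BfullG, SstarG_eq_SfullG hsym htri (pow_pos hp.pos t) b
    hcop]
  rw [htot, show (((p ^ t : ℕ) : ℤ) ^ 2) = ((p ^ (2 * t) : ℕ) : ℤ) by push_cast; ring,
    Nat.cast_mul, mul_pow, mul_inv, mul_comm (((p ^ k : ℕ) : ℂ) ^ s)⁻¹, mul_assoc]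

theorem statement10 {s : ℕ} (M : Matrix (Fin s) (Fin s) ℤ) (hsym : M.IsSymm)
    (htri : TransInv M) (p : ℕ) (hp : Nat.Prime p) (b : ℤ)
    (hb : Int.gcd b (p : ℤ) = 1) (t : ℕ) (ht : 1 ≤ t) :
    ∀ K : ℕ, ∑ k ∈ Finset.range (2 * t + K + 1), BstarG M (p ^ t) b (p ^ k) =
      ((p : ℂ) ^ (2 * t) / (Nat.totient (p ^ t) : ℂ) ^ s) *
        ∑ k ∈ Finset.range (K + 1), BfullG M (p ^ k) := by
  intro K
  simp only [BstarG_prime_pow hsym htri hp hb ht]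
  rw [← Finset.mul_sum, sum_BfullG_prime_pow _ hp, sum_BfullG_prime_pow _ hp,
    add_comm (2 * t) K, pow_add, totalG_smul M (pow_pos hp.pos K) (pow_pos hp.pos _)]
  push_cast
  ring
end
end
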